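/- Let n ≥ 599 and d = 4. For generic f ∈ S^4, the following holds: if T ⊆ S^2 = R_f^2 is a Zariski-closed algebraic subset of dimension ≥ n+1 such that for all A, B ∈ T the class of AB in R_f^4 is a square (AB mod J_f ∈ Sq_f^4), then T = Sq^2 := {A² : A ∈ S^1}, the set of squares of linear forms. -/

import Mathlib

open MvPolynomial

noncomputable section

abbrev S (n : ℕ) : Type := MvPolynomial (Fin (n + 1)) ℂ

/-- The Jacobian ideal of `f`, generated by its partial derivatives. -/
def jacobianIdeal {n : ℕ} (f : S n) : Ideal (S n) :=
  Ideal.span (Set.range fun i => MvPolynomial.pderiv i f)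

/-- The degree-`k` graded piece of `S/I`: the image of the homogeneous degree-`k`
polynomials in the quotient. -/
def quotPiece {n : ℕ} (I : Ideal (S n)) (k : ℕ) : Submodule ℂ (S n ⧸ I) :=
  (MvPolynomial.homogeneousSubmodule (Fin (n + 1)) ℂ k).map
    (Ideal.Quotient.mkₐ ℂ I).toLinearMap

/-- The degree-`k` graded piece `R_f^k` of the Jacobian ring `R_f = S/J_f`. -/
def Rpiece {n : ℕ} (f : S n) (k : ℕ) : Submodule ℂ (S n ⧸ jacobianIdeal f) :=
  quotPiece (jacobianIdeal f) k

/-- `f` defines a smooth hypersurface: its partial derivatives have no common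
zero in `ℂ^{n+1} \ {0}`. -/
def SmoothHyp {n : ℕ} (f : S n) : Prop :=
  ∀ v : Fin (n + 1) → ℂ, (∀ i, MvPolynomial.eval v (MvPolynomial.pderiv i f) = 0) → v = 0

/-- A polynomial function on a complex vector space: an element of the algebra of
functions generated by the linear functionals. -/
def IsPolyFun {M : Type} [AddCommGroup M] [Module ℂ M] (φ : M → ℂ) : Prop :=
  φ ∈ Algebra.adjoin ℂ {ψ : M → ℂ | ∃ l : M →ₗ[ℂ] ℂ, ψ = ⇑l}

/-- A property `P` holds for generic points of `M`: it holds on a nonempty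
Zariski-open subset, i.e. on the nonvanishing locus of some polynomial function
that is not identically zero. -/
def GenericallyHolds {M : Type} [AddCommGroup M] [Module ℂ M] (P : M → Prop) : Prop :=
  ∃ φ : M → ℂ, IsPolyFun φ ∧ (∃ x, φ x ≠ 0) ∧ ∀ x, φ x ≠ 0 → P x

/-- Substitution of the linear change of coordinates given by the matrix `A`. -/
def substLin {n : ℕ} (A : Matrix (Fin (n + 1)) (Fin (n + 1)) ℂ) (f : S n) : S n :=
  MvPolynomial.aeval (fun i => ∑ j, A i j • MvPolynomial.X j) f

/-- A regular sequence: each `f i` is a nonzerodivisor modulo the previous ones. -/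
def IsRegularSeq {n c : ℕ} (f : Fin c → S n) : Prop :=
  ∀ (i : Fin c) (g : S n),
    f i * g ∈ Ideal.span (f '' {j | j < i}) → g ∈ Ideal.span (f '' {j | j < i})

/-- Zariski-closed subset of a complex vector space: common zero locus of a set of
polynomial functions. -/
def IsZariskiClosed {M : Type} [AddCommGroup M] [Module ℂ M] (T : Set M) : Prop :=
  ∃ 𝒮 : Set (M → ℂ), (∀ φ ∈ 𝒮, IsPolyFun φ) ∧ T = {x | ∀ φ ∈ 𝒮, φ x = 0}

/-- An irreducible Zariski-closed subset. -/
def IsIrredClosed {M : Type} [AddCommGroup M] [Module ℂ M] (Z : Set M) : Prop :=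
  IsZariskiClosed Z ∧ Z.Nonempty ∧
    ∀ C₁ C₂ : Set M, IsZariskiClosed C₁ → IsZariskiClosed C₂ →
      Z ⊆ C₁ ∪ C₂ → Z ⊆ C₁ ∨ Z ⊆ C₂

/-- The (Krull) dimension of the algebraic set `T` is at least `m`: there is a strictly
increasing chain of `m+1` irreducible closed subsets contained in `T`. -/
def algDimGE {M : Type} [AddCommGroup M] [Module ℂ M] (T : Set M) (m : ℕ) : Prop :=
  ∃ Z : Fin (m + 1) → Set M, StrictMono Z ∧ (∀ i, IsIrredClosed (Z i)) ∧
    Z (Fin.last m) ⊆ T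

theorem exists_ne_zero_eval_comp_eq_zero {σ τ : Type} [Fintype σ] [Fintype τ]
    (g : τ → MvPolynomial σ ℂ) (h : Fintype.card σ < Fintype.card τ) :
    ∃ P : MvPolynomial τ ℂ, P ≠ 0 ∧ ∀ y : σ → ℂ, eval (fun t => eval y (g t)) P = 0 := by
  have hg : ¬ AlgebraicIndependent ℂ g := fun hg => by
    have h1 := hg.cardinalMk_le_trdeg
    rw [MvPolynomial.trdeg_of_isDomain] at h1
    simp at h1
    omega
  rw [algebraicIndependent_iff] at hg
  push Not at hg
  obtain ⟨P, hP, hP0⟩ := hg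
  refine ⟨P, hP0, fun y => ?_⟩
  have := congrArg (eval y) hP
  rw [map_zero, ← MvPolynomial.coe_aeval_eq_eval, RingHom.coe_coe,
    ← AlgHom.comp_apply, MvPolynomial.comp_aeval, ] at this
  simpa [MvPolynomial.coe_aeval_eq_eval, MvPolynomial.aeval_eq_eval] using this

theorem Matrix.exists_fin_submatrix_col {ρ τ : Type} [Fintype ρ] [Fintype τ]
    (B : Matrix ρ τ ℂ) {r : ℕ} (hr : r ≤ B.rank) :
    ∃ I : Fin r → τ, LinearIndependent ℂ (B.submatrix id I).col := by
  rw [Matrix.rank_eq_finrank_span_cols] at hr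
  obtain ⟨f, hf, -, hli⟩ := Submodule.exists_fun_fin_finrank_span_eq ℂ (Set.range B.col)
  choose I hI using hf
  refine ⟨fun i => I (Fin.castLE hr i), ?_⟩
  have h : (B.submatrix id fun i => I (Fin.castLE hr i)).col = f ∘ Fin.castLE hr := by
    ext i j
    exact congrFun (hI (Fin.castLE hr i)) j
  rw [h]
  exact hli.comp _ (Fin.castLE_injective hr)

theorem Matrix.exists_det_submatrix_ne_zero {ρ τ : Type} [Fintype ρ] [Fintype τ]
    (B : Matrix ρ τ ℂ) {r : ℕ} (hr : r ≤ B.rank) :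
    ∃ (I : Fin r → τ) (J : Fin r → ρ), Function.Injective I ∧ (B.submatrix J I).det ≠ 0 := by
  obtain ⟨I, hI⟩ := B.exists_fin_submatrix_col hr
  have hr' : r ≤ (B.submatrix id I).transpose.rank := by
    rw [Matrix.rank_transpose, Matrix.rank_eq_finrank_span_cols, finrank_span_eq_card hI]
    simp
  obtain ⟨J, hJ⟩ := Matrix.exists_fin_submatrix_col _ hr'
  refine ⟨I, J, fun a b hab => hI.injective ?_, ?_⟩
  · ext j; simp [hab, Matrix.col]
  · have : LinearIndependent ℂ (B.submatrix J I).row := hJ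
    rw [Matrix.linearIndependent_rows_iff_isUnit, Matrix.isUnit_iff_isUnit_det] at this
    exact this.ne_zero

theorem exists_ne_zero_of_det_submatrix {σ τ ρ : Type} [Fintype σ] [Fintype τ]
    (D : Matrix ρ τ (MvPolynomial σ ℂ)) (g : ρ → MvPolynomial σ ℂ) {r : ℕ}
    (hr : Fintype.card σ + 1 < r) (I : Fin r → τ) (J : Fin r → ρ) (hI : Function.Injective I) :
    ∃ P : MvPolynomial τ ℂ, P ≠ 0 ∧ ∀ (y : σ → ℂ) (f : τ → ℂ),
      ((D.map (eval y)).submatrix J I).det ≠ 0 →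
      (D.map (eval y)).mulVec f = (fun i => eval y (g i)) → eval f P = 0 := by
  classical
  let κ := {t : τ // t ∉ Set.range I}
  let up : MvPolynomial σ ℂ →+* MvPolynomial (Option (σ ⊕ κ)) ℂ :=
    (rename (R := ℂ) (fun s : σ => (some (Sum.inl s) : Option (σ ⊕ κ)))).toRingHom
  let D' := D.map up
  let w : τ → MvPolynomial (Option (σ ⊕ κ)) ℂ := fun t =>
    if h : t ∉ Set.range I then X (some (Sum.inr ⟨t, h⟩)) else 0
  let v : Fin r → MvPolynomial (Option (σ ⊕ κ)) ℂ :=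
    (X none : MvPolynomial (Option (σ ⊕ κ)) ℂ) • ((D'.submatrix J I).adjugate.mulVec (fun j => up (g (J j)) - (D'.mulVec w) (J j)))
  let G : τ → MvPolynomial (Option (σ ⊕ κ)) ℂ := fun t =>
    if h : t ∈ Set.range I then v h.choose else w t
  have hcard : Fintype.card κ + r = Fintype.card τ := by
    have h1 : Fintype.card (Set.range I) = r := by
      rw [Set.card_range_of_injective hI, Fintype.card_fin]
    have h2 : Fintype.card κ = Fintype.card τ - Fintype.card (Set.range I) :=
      Fintype.card_subtype_compl (fun t => t ∈ Set.range I)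
    have := Fintype.card_le_of_injective I hI
    simp at this
    omega
  obtain ⟨P, hP0, hP⟩ := exists_ne_zero_eval_comp_eq_zero G (by
    simp only [Fintype.card_option, Fintype.card_sum]; omega)
  refine ⟨P, hP0, fun y f hdet hf => ?_⟩
  let Y : Option (σ ⊕ κ) → ℂ := fun o => o.elim (((D.map (eval y)).submatrix J I).det)⁻¹
    (Sum.elim y (fun k => f k))
  have hup : ∀ p, eval Y (up p) = eval y p := fun p => by
    change eval Y (rename _ p) = _
    rw [eval_rename]; rfl
  have hD' : D'.map (eval Y) = D.map (eval y) := by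
    ext a b; simp [D', hup]
  have hw : ∀ t, eval Y (w t) = if t ∈ Set.range I then 0 else f t := fun t => by
    by_cases h : t ∈ Set.range I
    · simp only [w, h, not_true_eq_false, dite_false, map_zero, if_true]
    · simp only [w, h, not_false_eq_true, dite_true, eval_X, if_false]; rfl
  set B := D.map (eval y) with hB
  have hsplit : ∀ j, eval Y (up (g (J j)) - (D'.mulVec w) (J j)) =
      ((B.submatrix J I).mulVec (f ∘ I)) j := fun j => by
    have h1 := congrFun hf (J j)
    have h2 : eval Y ((D'.mulVec w) (J j)) =
        (B.mulVec (fun t => if t ∈ Set.range I then 0 else f t)) (J j) := by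
      rw [RingHom.map_mulVec, hD']
      congr 1
      exact _root_.funext hw
    rw [map_sub, hup, h2, ← h1]
    simp only [Matrix.mulVec, dotProduct, Matrix.submatrix_apply, Function.comp]
    rw [← Finset.sum_sub_distrib]
    rw [← Finset.sum_image (s := Finset.univ) (g := I) (f := fun t => B (J j) t * f t)
      (fun a _ b _ h => hI h)]
    rw [← Finset.sum_subset (Finset.subset_univ (Finset.univ.image I))]
    · refine Finset.sum_congr rfl fun t ht => ?_
      have : t ∈ Set.range I := by simpa using ht
      simp only [this, if_true, mul_zero, sub_zero]
    · intro t _ ht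
      have : t ∉ Set.range I := by simpa using ht
      simp only [this, if_false, sub_self]
  have hv : ∀ j, eval Y (v j) = f (I j) := fun j => by
    have h3 : eval Y (v j) = (B.submatrix J I).det⁻¹ •
        ((B.submatrix J I).adjugate.mulVec ((B.submatrix J I).mulVec (f ∘ I))) j := by
      simp only [v, Pi.smul_apply, smul_eq_mul, map_mul, eval_X]
      congr 1
      have h4 : (D'.submatrix J I).adjugate.map (eval Y) = (B.submatrix J I).adjugate := by
        have := (eval Y).map_adjugate (D'.submatrix J I)
        rw [RingHom.mapMatrix_apply, RingHom.mapMatrix_apply, ← Matrix.submatrix_map, hD'] at this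
        exact this
      rw [RingHom.map_mulVec, h4]
      congr 1
      exact _root_.funext hsplit
    rw [h3, Matrix.mulVec_mulVec, Matrix.adjugate_mul, Matrix.smul_mulVec, Matrix.one_mulVec]
    simp [hdet]
  have hG : (fun t => eval Y (G t)) = f := by
    funext t
    by_cases h : t ∈ Set.range I
    · simp only [G, h, dite_true, hv]
      exact congrArg f h.choose_spec
    · simp only [G, h, dite_false, hw, if_false]
  have := hP Y
  rwa [hG] at this

theorem exists_ne_zero_of_rank_ge {σ τ ρ : Type} [Fintype σ] [Fintype τ] [Fintype ρ]
    (D : Matrix ρ τ (MvPolynomial σ ℂ)) (g : ρ → MvPolynomial σ ℂ) {r : ℕ}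
    (hr : Fintype.card σ + 1 < r) :
    ∃ P : MvPolynomial τ ℂ, P ≠ 0 ∧ ∀ (y : σ → ℂ) (f : τ → ℂ),
      r ≤ (D.map (eval y)).rank →
      (D.map (eval y)).mulVec f = (fun i => eval y (g i)) → eval f P = 0 := by
  have key : ∀ q : (Fin r → τ) × (Fin r → ρ),
      ∃ P : MvPolynomial τ ℂ, P ≠ 0 ∧ ∀ (y : σ → ℂ) (f : τ → ℂ), Function.Injective q.1 →
      ((D.map (eval y)).submatrix q.2 q.1).det ≠ 0 →
      (D.map (eval y)).mulVec f = (fun i => eval y (g i)) → eval f P = 0 := fun q => by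
    by_cases hq : Function.Injective q.1
    · obtain ⟨P, hP0, hP⟩ := exists_ne_zero_of_det_submatrix D g hr q.1 q.2 hq
      exact ⟨P, hP0, fun y f _ => hP y f⟩
    · exact ⟨1, one_ne_zero, fun y f h => absurd h hq⟩
  choose P hP0 hP using key
  have := Fintype.ofFinite ((Fin r → τ) × (Fin r → ρ))
  refine ⟨∏ q, P q, Finset.prod_ne_zero_iff.2 fun q _ => hP0 q, fun y f hrk hf => ?_⟩
  obtain ⟨I, J, hI, hdet⟩ := Matrix.exists_det_submatrix_ne_zero _ hrk
  rw [map_prod]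
  exact Finset.prod_eq_zero (Finset.mem_univ (I, J)) (hP (I, J) y f hI hdet hf)

theorem homogeneousComponent_mul_of_isHomogeneous {n : ℕ} {a b : S n} {i j : ℕ}
    (ha : a.IsHomogeneous i) :
    homogeneousComponent (i + j) (a * b) = a * homogeneousComponent j b := by
  let _ := MvPolynomial.gradedAlgebra (σ := Fin (n + 1)) (R := ℂ)
  have h := DirectSum.coe_decompose_mul_add_of_left_mem
    (homogeneousSubmodule (Fin (n + 1)) ℂ) (i := i) (j := j) (a := a) (b := b) ha
  have hd (p : S n) (k : ℕ) : (DirectSum.decompose (homogeneousSubmodule (Fin (n + 1)) ℂ) p k : S n) =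
      homogeneousComponent k p := decomposition.decompose'_apply p k
  rwa [hd, hd] at h

instance finite_homogeneousSubmodule (n k : ℕ) :
    Module.Finite ℂ (homogeneousSubmodule (Fin (n + 1)) ℂ k) :=
  Module.Finite.iff_fg.2 (homogeneousSubmodule_fg _ _ k)

theorem finrank_homogeneousSubmodule (n k : ℕ) :
    Module.finrank ℂ (homogeneousSubmodule (Fin (n + 1)) ℂ k) = (n + 1).multichoose k := by
  rw [homogeneousSubmodule_eq_finsupp_supported,
    (AddMonoidAlgebra.supportedEquivFinsupp (R := ℂ) (S := ℂ)
      {d : Fin (n + 1) →₀ ℕ | d.degree = k}).finrank_eq]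
  have e : {d : Fin (n + 1) →₀ ℕ // d.degree = k} ≃ Sym (Fin (n + 1)) k :=
    (Equiv.subtypeEquivRight fun d => by rfl).trans
      (Sym.equivNatSum (Fin (n + 1)) k).symm
  have := Fintype.ofEquiv _ e.symm
  have h := Module.finrank_finsupp_self ℂ (ι := {d : Fin (n + 1) →₀ ℕ // d.degree = k})
  rw [Fintype.card_congr e, Sym.card_sym_eq_multichoose, Fintype.card_fin] at h
  exact h

theorem card_parameters_lt_multichoose {n : ℕ} (hn : 599 ≤ n) :
    (n + 1) * (n + 1) + 3 * (n + 1).multichoose 2 + 1 + (n + 1).multichoose 2 <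
      (n + 1).multichoose 3 := by
  rw [Nat.multichoose_eq, Nat.multichoose_eq]
  have h2 : (n + 1 + 2 - 1).choose 2 * 2 = (n + 2) * (n + 1) := by
    have := Nat.add_one_mul_choose_eq (n + 1) 1
    simp at this ⊢
    linarith
  have h3 : (n + 1 + 3 - 1).choose 3 * 3 = (n + 3) * (n + 1 + 2 - 1).choose 2 := by
    have := Nat.add_one_mul_choose_eq (n + 2) 2
    simp at this ⊢
    linarith
  nlinarith

theorem prime_of_isHomogeneous_one {n : ℕ} {x : S n} (hx : x.IsHomogeneous 1) (h0 : x ≠ 0) :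
    Prime x := by
  rw [← UniqueFactorizationMonoid.irreducible_iff_prime]
  refine irreducible_of_totalDegree_eq_one (hx.totalDegree h0) fun c hc => ?_
  rw [isUnit_iff_ne_zero]
  rintro rfl
  exact h0 (by ext i; simpa using hc i)

/-- The derivation sending `X i` to `L i`. -/
def derivAlong {n : ℕ} (L : Fin (n + 1) → S n) : Derivation ℂ (S n) (S n) :=
  ∑ i, L i • pderiv i

theorem derivAlong_apply {n : ℕ} (L : Fin (n + 1) → S n) (f : S n) :
    derivAlong L f = ∑ i, L i * pderiv i f := by
  have h := congrFun (map_sum Derivation.coeFnAddMonoidHom (fun i => L i • pderiv i) Finset.univ) f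
  rw [Finset.sum_apply] at h
  exact h

theorem derivAlong_X {n : ℕ} (L : Fin (n + 1) → S n) (i : Fin (n + 1)) :
    derivAlong L (X i) = L i := by
  rw [derivAlong_apply, Finset.sum_eq_single i]
  · simp
  · intro j _ hj
    rw [pderiv_X_of_ne hj.symm, mul_zero]
  · simp

theorem isHomogeneous_derivAlong {n k : ℕ} {L : Fin (n + 1) → S n}
    (hL : ∀ i, (L i).IsHomogeneous 1) {f : S n} (hf : f.IsHomogeneous (k + 1)) :
    (derivAlong L f).IsHomogeneous (k + 1) := by
  rw [derivAlong_apply]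
  refine IsHomogeneous.sum _ _ _ fun i _ => ?_
  have := (hL i).mul (hf.pderiv (i := i))
  rwa [Nat.add_sub_cancel, add_comm 1 k] at this

/-- Multiplication by a linear form, from degree `k` to degree `k + 1`. -/
def mulLinear {n : ℕ} (x : S n) (hx : x.IsHomogeneous 1) (k : ℕ) :
    homogeneousSubmodule (Fin (n + 1)) ℂ k →ₗ[ℂ] homogeneousSubmodule (Fin (n + 1)) ℂ (k + 1) :=
  (LinearMap.mulLeft ℂ x).restrict fun f hf => by
    have := hx.mul ((mem_homogeneousSubmodule _ _).1 hf)
    rwa [add_comm 1 k] at this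

theorem exists_derivAlong_not_proportional_or_scalar {n : ℕ} (L : Fin (n + 1) → S n) :
    (∃ x : S n, x.IsHomogeneous 1 ∧ ∀ c : ℂ, derivAlong L x ≠ c • x) ∨
      ∃ c : ℂ, ∀ i, L i = c • X i := by
  by_cases h : ∃ x : S n, x.IsHomogeneous 1 ∧ ∀ c : ℂ, derivAlong L x ≠ c • x
  · exact Or.inl h
  right
  push Not at h
  have h1 : ∀ i, ∃ c : ℂ, L i = c • X i := fun i => by
    obtain ⟨c, hc⟩ := h (X i) (isHomogeneous_X _ _)
    exact ⟨c, by rw [← hc, derivAlong_X]⟩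
  choose c hc using h1
  refine ⟨c 0, fun i => ?_⟩
  rcases eq_or_ne i 0 with rfl | hi
  · exact hc 0
  obtain ⟨d, hd⟩ := h (X i + X 0) ((isHomogeneous_X _ _).add (isHomogeneous_X _ _))
  rw [map_add, derivAlong_X, derivAlong_X, hc, hc] at hd
  have hs : Finsupp.single i 1 ≠ (Finsupp.single 0 1 : Fin (n + 1) →₀ ℕ) := fun h =>
    hi (Finsupp.single_left_injective one_ne_zero h)
  have e1 := congrArg (coeff (Finsupp.single i 1)) hd
  have e2 := congrArg (coeff (Finsupp.single 0 1)) hd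
  simp [coeff_X, hs, hs.symm] at e1 e2
  rw [hc, e1, ← e2]

theorem finrank_le_finrank_range_add {n : ℕ} {L : Fin (n + 1) → S n}
    (hL : ∀ i, (L i).IsHomogeneous 1) (h0 : ∃ i, L i ≠ 0)
    (T : homogeneousSubmodule (Fin (n + 1)) ℂ 4 →ₗ[ℂ] homogeneousSubmodule (Fin (n + 1)) ℂ 4)
    (hT : ∀ f, (T f : S n) = derivAlong L f) :
    Module.finrank ℂ (homogeneousSubmodule (Fin (n + 1)) ℂ 3) ≤
      Module.finrank ℂ (LinearMap.range T) +
      Module.finrank ℂ (homogeneousSubmodule (Fin (n + 1)) ℂ 2) := by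
  suffices h : ∃ (x : S n) (hx : x.IsHomogeneous 1),
      ∀ m : homogeneousSubmodule (Fin (n + 1)) ℂ 3, derivAlong L (x * m) = 0 →
        m ∈ LinearMap.range (mulLinear x hx 2) by
    obtain ⟨x, hx, h⟩ := h
    rw [← LinearMap.finrank_range_add_finrank_ker (T ∘ₗ mulLinear x hx 3)]
    gcongr
    · exact Submodule.finrank_mono (LinearMap.range_comp_le_range _ _)
    · calc _ ≤ Module.finrank ℂ (LinearMap.range (mulLinear x hx 2)) := by
            refine Submodule.finrank_mono fun m hm => h m ?_
            have h2 := congrArg Subtype.val (LinearMap.mem_ker.1 hm)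
            rwa [LinearMap.comp_apply, hT] at h2
        _ ≤ _ := LinearMap.finrank_range_le _
  rcases exists_derivAlong_not_proportional_or_scalar L with ⟨x, hx, hne⟩ | ⟨c, hc⟩
  · refine ⟨x, hx, fun m hm => ?_⟩
    have hx0 : x ≠ 0 := by
      rintro rfl
      exact hne 0 (by simp)
    have hp := prime_of_isHomogeneous_one hx hx0
    have hdx : (derivAlong L x).IsHomogeneous 1 := isHomogeneous_derivAlong (k := 0) hL hx
    rw [Derivation.leibniz, smul_eq_mul, smul_eq_mul] at hm
    have hdvd : x ∣ (m : S n) * derivAlong L x := by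
      rw [eq_neg_of_add_eq_zero_right hm]
      exact (dvd_mul_right _ _).neg_right
    rcases hp.dvd_or_dvd hdvd with ⟨q, hq⟩ | ⟨q, hq⟩
    · refine ⟨⟨homogeneousComponent 2 q, homogeneousComponent_mem _ _⟩, Subtype.ext ?_⟩
      change x * homogeneousComponent 2 q = m
      rw [← homogeneousComponent_mul_of_isHomogeneous hx (j := 2), ← hq]
      exact homogeneousComponent_eq_self m.2
    · exfalso
      have h1 := homogeneousComponent_mul_of_isHomogeneous hx (j := 0) (b := q)
      rw [← hq, homogeneousComponent_eq_self (p := derivAlong L x) (by exact hdx), homogeneousComponent_zero] at h1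
      exact hne _ (by rw [h1, smul_eq_C_mul, mul_comm])
  · have hc0 : c ≠ 0 := by
      rintro rfl
      obtain ⟨i, hi⟩ := h0
      exact hi (by rw [hc, zero_smul])
    refine ⟨X 0, isHomogeneous_X _ _, fun m hm => ?_⟩
    have h4 : (X 0 * (m : S n)).IsHomogeneous 4 := (isHomogeneous_X ℂ 0).mul m.2
    have he : derivAlong L (X 0 * (m : S n)) = c • (4 : ℕ) • (X 0 * (m : S n)) := by
      rw [derivAlong_apply, ← h4.sum_X_mul_pderiv, Finset.smul_sum]
      exact Finset.sum_congr rfl fun i _ => by rw [hc, smul_mul_assoc]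
    rw [he] at hm
    have : m = 0 := by
      ext1
      simpa [hc0] using hm
    rw [this]
    exact zero_mem _

theorem isPolyFun_eval {M τ : Type} [AddCommGroup M] [Module ℂ M] (l : τ → M →ₗ[ℂ] ℂ)
    (P : MvPolynomial τ ℂ) : IsPolyFun fun f => eval (fun t => l t f) P := by
  unfold IsPolyFun
  induction P using MvPolynomial.induction_on with
  | C a =>
    simp only [eval_C]
    exact Subalgebra.algebraMap_mem _ a
  | add p q hp hq =>
    simp only [map_add]
    exact add_mem hp hq
  | mul_X p i hp =>
    simp only [map_mul, eval_X]
    exact mul_mem hp (Algebra.subset_adjoin ⟨l i, rfl⟩)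

theorem exists_derivAlong_eq_of_mem_jacobianIdeal {n : ℕ} {f p : S n} (hf : f.IsHomogeneous 4)
    (hp : p.IsHomogeneous 4) (h : p ∈ jacobianIdeal f) :
    ∃ L : Fin (n + 1) → S n, (∀ i, (L i).IsHomogeneous 1) ∧ p = derivAlong L f := by
  obtain ⟨c, hc⟩ := (Ideal.mem_span_range_iff_exists_fun).1 h
  refine ⟨fun i => homogeneousComponent 1 (c i), fun i => homogeneousComponent_isHomogeneous _ _, ?_⟩
  rw [derivAlong_apply, ← homogeneousComponent_eq_self (p := p) hp, ← hc, map_sum]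
  refine Finset.sum_congr rfl fun i _ => ?_
  rw [mul_comm, homogeneousComponent_mul_of_isHomogeneous (i := 3) (j := 1) (hf.pderiv (i := i)),
    mul_comm]

theorem exists_eq_sum_smul_X {n : ℕ} {x : S n} (hx : x.IsHomogeneous 1) :
    ∃ y : Fin (n + 1) → ℂ, x = ∑ j, y j • X j := by
  have h : x ∈ homogeneousSubmodule (Fin (n + 1)) ℂ 1 := hx
  rw [homogeneousSubmodule_one_eq_span_X, Submodule.mem_span_range_iff_exists_fun] at h
  obtain ⟨y, hy⟩ := h
  exact ⟨y, hy.symm⟩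

/-- The operator `X j * ∂/∂X i` on quartic forms. -/
def elementaryDeriv {n : ℕ} (p : Fin (n + 1) × Fin (n + 1)) :
    homogeneousSubmodule (Fin (n + 1)) ℂ 4 →ₗ[ℂ] homogeneousSubmodule (Fin (n + 1)) ℂ 4 :=
  (LinearMap.mulLeft ℂ (X p.2) ∘ₗ (pderiv p.1 : Derivation ℂ (S n) (S n)).toLinearMap).restrict
    fun _ hf => (isHomogeneous_X ℂ p.2).mul (IsHomogeneous.pderiv (i := p.1) hf)

theorem coe_elementaryDeriv {n : ℕ} (p : Fin (n + 1) × Fin (n + 1))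
    (f : homogeneousSubmodule (Fin (n + 1)) ℂ 4) :
    (elementaryDeriv p f : S n) = X p.2 * pderiv p.1 (f : S n) := rfl

theorem coe_sum_elementaryDeriv {n : ℕ} (y : Fin (n + 1) → Fin (n + 1) → ℂ)
    (f : homogeneousSubmodule (Fin (n + 1)) ℂ 4) :
    (((∑ p : Fin (n + 1) × Fin (n + 1), y p.1 p.2 • elementaryDeriv p) f :
      homogeneousSubmodule (Fin (n + 1)) ℂ 4) : S n) =
      derivAlong (fun i => ∑ j, y i j • X j) f := by
  rw [derivAlong_apply, LinearMap.sum_apply, Submodule.coe_sum, Fintype.sum_prod_type]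
  refine Finset.sum_congr rfl fun i _ => ?_
  rw [Finset.sum_mul]
  refine Finset.sum_congr rfl fun j _ => ?_
  rw [LinearMap.smul_apply, Submodule.coe_smul, coe_elementaryDeriv, smul_mul_assoc]

/-- The product of two quadratic forms, as a quartic form. -/
def mulQuadrics {n : ℕ} (A B : homogeneousSubmodule (Fin (n + 1)) ℂ 2) :
    homogeneousSubmodule (Fin (n + 1)) ℂ 4 :=
  ⟨A * B, IsHomogeneous.mul A.2 B.2⟩

theorem coe_sum_smul_mulQuadrics {n : ℕ} {κ : Type} [Fintype κ]
    (b : Module.Basis κ ℂ (homogeneousSubmodule (Fin (n + 1)) ℂ 2))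
    (A B C : homogeneousSubmodule (Fin (n + 1)) ℂ 2) :
    ((∑ k, ∑ l, (b.repr A k * b.repr B l - b.repr C k * b.repr C l) • mulQuadrics (b k) (b l) :
      homogeneousSubmodule (Fin (n + 1)) ℂ 4) : S n) = A * B - C ^ 2 := by
  have h (A B : homogeneousSubmodule (Fin (n + 1)) ℂ 2) :
      (A : S n) * B = ∑ k, ∑ l, (b.repr A k * b.repr B l) • ((b k : S n) * b l) := by
    have hA (A : homogeneousSubmodule (Fin (n + 1)) ℂ 2) :
        (A : S n) = ∑ k, b.repr A k • (b k : S n) := by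
      conv_lhs => rw [← b.sum_repr A]
      rw [Submodule.coe_sum]
      rfl
    rw [hA A, hA B, Finset.sum_mul_sum]
    simp only [smul_mul_smul_comm]
  rw [pow_two, h A B, h C C, ← Finset.sum_sub_distrib, Submodule.coe_sum]
  refine Finset.sum_congr rfl fun k _ => ?_
  rw [← Finset.sum_sub_distrib, Submodule.coe_sum]
  refine Finset.sum_congr rfl fun l _ => ?_
  rw [← sub_smul]
  rfl

theorem generically_mul_eq_sq {n : ℕ} (hn : 599 ≤ n) :
    GenericallyHolds (fun f : homogeneousSubmodule (Fin (n + 1)) ℂ 4 =>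
      ∀ A B C : S n, A.IsHomogeneous 2 → B.IsHomogeneous 2 → C.IsHomogeneous 2 →
        A * B - C ^ 2 ∈ jacobianIdeal (f : S n) → A * B = C ^ 2) := by
  let b2 := Module.finBasis ℂ (homogeneousSubmodule (Fin (n + 1)) ℂ 2)
  let b4 := Module.finBasis ℂ (homogeneousSubmodule (Fin (n + 1)) ℂ 4)
  let κ := Fin (Module.finrank ℂ (homogeneousSubmodule (Fin (n + 1)) ℂ 2))
  let τ := Fin (Module.finrank ℂ (homogeneousSubmodule (Fin (n + 1)) ℂ 4))
  let σ := (Fin (n + 1) × Fin (n + 1)) ⊕ (Fin 3 × κ)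
  let D : Matrix τ τ (MvPolynomial σ ℂ) := Matrix.of fun s t =>
    ∑ p, X (Sum.inl p) * C (LinearMap.toMatrix b4 b4 (elementaryDeriv p) s t)
  let g : τ → MvPolynomial σ ℂ := fun t => ∑ k : κ, ∑ l : κ,
    (X (Sum.inr (0, k)) * X (Sum.inr (1, l)) - X (Sum.inr (2, k)) * X (Sum.inr (2, l))) *
      C (b4.repr (mulQuadrics (b2 k) (b2 l)) t)
  have hcard : Fintype.card σ + 1 <
      (n + 1).multichoose 3 - (n + 1).multichoose 2 := by
    have h := card_parameters_lt_multichoose hn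
    simp only [σ, κ, Fintype.card_sum, Fintype.card_prod, Fintype.card_fin,
      finrank_homogeneousSubmodule]
    omega
  obtain ⟨P, hP0, hP⟩ := exists_ne_zero_of_rank_ge D g hcard
  refine ⟨fun f => eval (fun t => b4.coord t f) P, isPolyFun_eval _ P, ?_, ?_⟩
  · by_contra! h
    refine hP0 (MvPolynomial.funext fun x => ?_)
    have h1 := h (b4.equivFun.symm x)
    simp only [Module.Basis.coord_equivFun_symm] at h1
    rw [h1, map_zero]
  · intro f hf A B Q hA hB hQ hmem
    obtain ⟨L, hL, hLf⟩ := exists_derivAlong_eq_of_mem_jacobianIdeal f.2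
      ((hA.mul hB).sub (hQ.pow 2)) hmem
    by_cases h0 : ∃ i, L i ≠ 0
    swap
    · push Not at h0
      rw [derivAlong_apply, Finset.sum_eq_zero fun i _ => by rw [h0, zero_mul]] at hLf
      exact sub_eq_zero.1 hLf
    exfalso
    choose y hy using fun i => exists_eq_sum_smul_X (hL i)
    let T : homogeneousSubmodule (Fin (n + 1)) ℂ 4 →ₗ[ℂ] homogeneousSubmodule (Fin (n + 1)) ℂ 4 :=
      ∑ p : Fin (n + 1) × Fin (n + 1), y p.1 p.2 • elementaryDeriv p
    have hT (f) : (T f : S n) = derivAlong L f := by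
      rw [_root_.funext hy]
      exact coe_sum_elementaryDeriv y f
    let z : Fin 3 × κ → ℂ := fun q =>
      b2.repr (![⟨A, hA⟩, ⟨B, hB⟩, ⟨Q, hQ⟩] q.1) q.2
    let Y : σ → ℂ := Sum.elim (fun p => y p.1 p.2) z
    have hD : D.map (eval Y) = LinearMap.toMatrix b4 b4 T := by
      ext s t
      simp only [T, D, map_sum, map_smul, Matrix.sum_apply, Matrix.map_apply, Matrix.of_apply,
        map_mul, eval_X, eval_C, Matrix.smul_apply, smul_eq_mul]
      rfl
    have hg (t) : eval Y (g t) = b4.repr (T f) t := by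
      have hq := coe_sum_smul_mulQuadrics b2 ⟨A, hA⟩ ⟨B, hB⟩ ⟨Q, hQ⟩
      rw [hLf, ← hT] at hq
      rw [← Subtype.ext hq]
      simp only [g, map_sum, map_smul, map_mul, map_sub, eval_X, eval_C, Finsupp.coe_finsetSum,
        Finset.sum_apply, Finsupp.smul_apply, smul_eq_mul]
      rfl
    refine hf (hP Y _ ?_ ?_)
    · have h := finrank_le_finrank_range_add hL h0 T hT
      rw [finrank_homogeneousSubmodule, finrank_homogeneousSubmodule] at h
      rw [hD, Matrix.rank_eq_finrank_range_toLin _ b4 b4, Matrix.toLin_toMatrix]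
      omega
    · rw [hD]
      ext t
      rw [hg]
      exact congrFun (LinearMap.toMatrix_mulVec_repr b4 b4 T f) t

theorem apply_eq_sum_mul_equivFun {M κ : Type} [AddCommGroup M] [Module ℂ M] [Fintype κ]
    (b : Module.Basis κ ℂ M) (l : M →ₗ[ℂ] ℂ) (A : M) :
    l A = ∑ k, l (b k) * b.equivFun A k := by
  conv_lhs => rw [← b.sum_equivFun A, map_sum]
  simp [mul_comm]

theorem IsPolyFun.exists_eq_eval {M κ : Type} [AddCommGroup M] [Module ℂ M] [Fintype κ]
    (b : Module.Basis κ ℂ M) {φ : M → ℂ} (hφ : IsPolyFun φ) :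
    ∃ p : MvPolynomial κ ℂ, ∀ A, φ A = eval (b.equivFun A) p := by
  unfold IsPolyFun at hφ
  induction hφ using Algebra.adjoin_induction with
  | mem φ h =>
    obtain ⟨l, rfl⟩ := h
    refine ⟨∑ k, C (l (b k)) * X k, fun A => ?_⟩
    rw [apply_eq_sum_mul_equivFun b]
    simp
  | algebraMap a => exact ⟨C a, fun A => by simp⟩
  | add φ ψ _ _ hp hq =>
    obtain ⟨p, hp⟩ := hp
    obtain ⟨q, hq⟩ := hq
    exact ⟨p + q, fun A => by simp [hp, hq]⟩
  | mul φ ψ _ _ hp hq =>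
    obtain ⟨p, hp⟩ := hp
    obtain ⟨q, hq⟩ := hq
    exact ⟨p * q, fun A => by simp [hp, hq]⟩

theorem isZariskiClosed_eval_eq_zero {M κ : Type} [AddCommGroup M] [Module ℂ M] [Fintype κ]
    (b : Module.Basis κ ℂ M) (p : MvPolynomial κ ℂ) :
    IsZariskiClosed {A | eval (b.equivFun A) p = 0} :=
  ⟨{fun A => eval (b.equivFun A) p}, by
    rintro _ rfl
    exact isPolyFun_eval b.coord p, by simp⟩

/-- The polynomials in the coordinates of the basis `b` that vanish on `Z`. -/
def coordVanishingIdeal {M κ : Type} [AddCommGroup M] [Module ℂ M] [Fintype κ]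
    (b : Module.Basis κ ℂ M) (Z : Set M) : Ideal (MvPolynomial κ ℂ) :=
  vanishingIdeal ℂ (b.equivFun '' Z)

theorem mem_coordVanishingIdeal {M κ : Type} [AddCommGroup M] [Module ℂ M] [Fintype κ]
    (b : Module.Basis κ ℂ M) {Z : Set M} {p : MvPolynomial κ ℂ} :
    p ∈ coordVanishingIdeal b Z ↔ ∀ A ∈ Z, eval (b.equivFun A) p = 0 := by
  simp [coordVanishingIdeal, mem_vanishingIdeal_iff]

theorem coordVanishingIdeal_lt {M κ : Type} [AddCommGroup M] [Module ℂ M] [Fintype κ]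
    (b : Module.Basis κ ℂ M) {Z Y : Set M} (hZ : IsZariskiClosed Z) (h : Z ⊂ Y) :
    coordVanishingIdeal b Y < coordVanishingIdeal b Z := by
  obtain ⟨hZY, x, hxY, hxZ⟩ := Set.ssubset_iff_exists.1 h
  refine SetLike.lt_iff_le_and_exists.2 ⟨fun p hp => ?_, ?_⟩
  · exact (mem_coordVanishingIdeal b).2 fun A hA => (mem_coordVanishingIdeal b).1 hp A (hZY hA)
  obtain ⟨𝒮, h𝒮, rfl⟩ := hZ
  simp only [Set.mem_ofPred_eq, not_forall] at hxZ
  obtain ⟨φ, hφ, hx⟩ := hxZ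
  obtain ⟨p, hp⟩ := (h𝒮 φ hφ).exists_eq_eval b
  refine ⟨p, (mem_coordVanishingIdeal b).2 fun A hA => ?_, fun hpY => hx ?_⟩
  · rw [← hp, hA φ hφ]
  · rw [hp, (mem_coordVanishingIdeal b).1 hpY x hxY]

theorem IsIrredClosed.isPrime_coordVanishingIdeal {M κ : Type} [AddCommGroup M] [Module ℂ M]
    [Fintype κ] (b : Module.Basis κ ℂ M) {Z : Set M} (hZ : IsIrredClosed Z) :
    (coordVanishingIdeal b Z).IsPrime := by
  obtain ⟨-, ⟨x, hx⟩, h⟩ := hZ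
  refine ⟨fun htop => ?_, fun {p q} hpq => ?_⟩
  · have h1 := (mem_coordVanishingIdeal b).1 ((Ideal.eq_top_iff_one _).1 htop) x hx
    simp at h1
  · simp only [mem_coordVanishingIdeal] at hpq ⊢
    exact h _ _ (isZariskiClosed_eval_eq_zero b p) (isZariskiClosed_eval_eq_zero b q)
      fun A hA => mul_eq_zero.1 (by simpa using hpq A hA)

theorem RingHom.IsIntegral.length_le_ringKrullDim {A B : Type*} [CommRing A] [CommRing B]
    {f : A →+* B} (hf : f.IsIntegral) (s : LTSeries (PrimeSpectrum A))
    (hs : RingHom.ker f ≤ s.head.asIdeal) : s.length ≤ ringKrullDim B := by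
  algebraize [f]
  suffices h : ∀ i : Fin (s.length + 1), ∃ Q : PrimeSpectrum B,
      Q.asIdeal.comap f = (s i).asIdeal ∧ (i : ℕ∞) ≤ Order.height Q by
    obtain ⟨Q, -, hQ⟩ := h (Fin.last _)
    refine le_trans ?_ (Order.height_le_krullDim Q)
    exact_mod_cast hQ
  intro i
  induction i using Fin.induction with
  | zero =>
    obtain ⟨Q, -, hQ, hQs⟩ := Ideal.exists_ideal_over_prime_of_isIntegral s.head.asIdeal
      (⊥ : Ideal B) hs
    exact ⟨⟨Q, hQ⟩, hQs, by simp⟩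
  | succ i ih =>
    obtain ⟨Q, hQs, hi⟩ := ih
    have hlt : s i.castSucc < s i.succ := s.strictMono Fin.castSucc_lt_succ
    obtain ⟨Q', hle, hQ', hQs'⟩ := Ideal.exists_ideal_over_prime_of_isIntegral (s i.succ).asIdeal
      Q.asIdeal (hQs.le.trans hlt.le)
    refine ⟨⟨Q', hQ'⟩, hQs', ?_⟩
    have hQQ : Q < ⟨Q', hQ'⟩ := by
      refine lt_of_le_of_ne hle ?_
      rintro rfl
      exact hlt.ne (PrimeSpectrum.ext (hQs.symm.trans hQs'))
    refine le_trans ?_ (Order.height_add_one_le hQQ)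
    simpa using add_le_add_left hi 1

/-- An algebraic set contained in the image of a finite polynomial parametrization by `ℂ^m` has
dimension at most `m`, and it is the whole image if it is closed of dimension `m`. -/
theorem algDimGE_subset_range {M κ : Type} [AddCommGroup M] [Module ℂ M] [Fintype κ]
    (b : Module.Basis κ ℂ M) {m : ℕ} (θ : MvPolynomial κ ℂ →ₐ[ℂ] MvPolynomial (Fin m) ℂ)
    (hθ : (θ : MvPolynomial κ ℂ →+* MvPolynomial (Fin m) ℂ).IsIntegral)
    (α : (Fin m → ℂ) → M) (hα : ∀ x p, eval x (θ p) = eval (b.equivFun (α x)) p)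
    {T : Set M} (hT : T ⊆ Set.range α) {k : ℕ} (hk : algDimGE T k) :
    k ≤ m ∧ (k = m → IsZariskiClosed T → T = Set.range α) := by
  have hker : coordVanishingIdeal b (Set.range α) =
      RingHom.ker (θ : MvPolynomial κ ℂ →+* MvPolynomial (Fin m) ℂ) := by
    ext p
    rw [mem_coordVanishingIdeal, Set.forall_mem_range, RingHom.mem_ker]
    simp only [← hα]
    exact ⟨fun h => MvPolynomial.funext fun x => by simpa using h x, fun h x => by
      change eval x ((θ : MvPolynomial κ ℂ →+* MvPolynomial (Fin m) ℂ) p) = 0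
      rw [h, map_zero]⟩
  have hdim : ringKrullDim (MvPolynomial (Fin m) ℂ) = m := by
    rw [MvPolynomial.ringKrullDim_of_isNoetherianRing]
    simp
  have hmono {Y Z : Set M} (h : Y ⊆ Z) : coordVanishingIdeal b Z ≤ coordVanishingIdeal b Y :=
    fun p hp => (mem_coordVanishingIdeal b).2 fun A hA => (mem_coordVanishingIdeal b).1 hp A (h hA)
  obtain ⟨Z, hZ, hirr, hlast⟩ := hk
  let s : LTSeries (PrimeSpectrum (MvPolynomial κ ℂ)) :=
    LTSeries.mk k (fun i => ⟨_, (hirr i.rev).isPrime_coordVanishingIdeal b⟩)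
      fun i j hij => coordVanishingIdeal_lt b (hirr j.rev).1 (hZ (Fin.rev_lt_rev.2 hij))
  have hhead : s.head.asIdeal = coordVanishingIdeal b (Z (Fin.last k)) := by
    change coordVanishingIdeal b (Z (Fin.rev 0)) = _
    rw [Fin.rev_zero]
  have hle : RingHom.ker (θ : MvPolynomial κ ℂ →+* MvPolynomial (Fin m) ℂ) ≤ s.head.asIdeal := by
    rw [hhead, ← hker]
    exact hmono (hlast.trans hT)
  refine ⟨?_, fun hkm hTc => by_contra fun hne => ?_⟩
  · have := hθ.length_le_ringKrullDim s hle
    rw [hdim] at this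
    exact_mod_cast this
  · have hlt : (⟨_, RingHom.ker_isPrime
        (θ : MvPolynomial κ ℂ →+* MvPolynomial (Fin m) ℂ)⟩ : PrimeSpectrum _) < s.head := by
      change RingHom.ker (θ : MvPolynomial κ ℂ →+* MvPolynomial (Fin m) ℂ) < s.head.asIdeal
      rw [hhead, ← hker]
      exact (coordVanishingIdeal_lt b hTc (hT.ssubset_of_ne hne)).trans_le (hmono hlast)
    have := hθ.length_le_ringKrullDim (s.cons _ hlt) (le_of_eq (by rw [RelSeries.head_cons]))
    rw [hdim, RelSeries.cons_length] at this
    have : k + 1 ≤ m := by exact_mod_cast this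
    omega

theorem eval_aeval_eq_eval {κ σ : Type} (x : σ → ℂ) (g : κ → MvPolynomial σ ℂ)
    (p : MvPolynomial κ ℂ) : eval x (aeval g p) = eval (fun k => eval x (g k)) p := by
  induction p using MvPolynomial.induction_on with
  | C a => simp
  | add p q hp hq => rw [map_add, map_add, hp, hq, map_add]
  | mul_X p i hp => rw [map_mul, map_mul, hp, aeval_X, map_mul, eval_X]

theorem isIntegral_of_forall_eq_X_pow {κ σ : Type} {θ : MvPolynomial κ ℂ →ₐ[ℂ] MvPolynomial σ ℂ}
    {N : ℕ} (hN : 0 < N) (h : ∀ i, ∃ p, θ p = X i ^ N) :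
    (θ : MvPolynomial κ ℂ →+* MvPolynomial σ ℂ).IsIntegral := by
  intro q
  induction q using MvPolynomial.induction_on with
  | C a =>
    have := RingHom.isIntegralElem_map (θ : MvPolynomial κ ℂ →+* MvPolynomial σ ℂ) (x := C a)
    rwa [RingHom.coe_coe, algHom_C] at this
  | add p q hp hq => exact hp.add _ hq
  | mul_X p i hp =>
    refine hp.mul _ ?_
    obtain ⟨p, hp⟩ := h i
    algebraize [(θ : MvPolynomial κ ℂ →+* MvPolynomial σ ℂ)]
    refine IsIntegral.of_pow (R := MvPolynomial κ ℂ) hN ?_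
    rw [← hp]
    exact isIntegral_algebraMap (R := MvPolynomial κ ℂ)

theorem le_one_of_algDimGE_line {M : Type} [AddCommGroup M] [Module ℂ M] [Module.Finite ℂ M]
    {A : M} (hA : A ≠ 0) {T : Set M} (hT : ∀ B ∈ T, ∃ c : ℂ, B = c • A) {k : ℕ}
    (hk : algDimGE T k) : k ≤ 1 := by
  let b := Module.finBasis ℂ M
  obtain ⟨j, hj⟩ : ∃ j, b.equivFun A j ≠ 0 := by
    by_contra! h
    exact hA (b.equivFun.map_eq_zero_iff.1 (_root_.funext h))
  let θ : MvPolynomial (Fin (Module.finrank ℂ M)) ℂ →ₐ[ℂ] MvPolynomial (Fin 1) ℂ :=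
    aeval fun j => C (b.equivFun A j) * X 0
  refine (algDimGE_subset_range b θ (isIntegral_of_forall_eq_X_pow one_pos fun i => ?_)
    (fun x => x 0 • A) (fun x p => ?_) (fun B hB => ?_) hk).1
  · refine ⟨C (b.equivFun A j)⁻¹ * X j, ?_⟩
    rw [map_mul, algHom_C, aeval_X, ← mul_assoc, algebraMap_eq, ← C_mul, inv_mul_cancel₀ hj,
      Subsingleton.elim i 0]
    simp
  · simp only [θ]
    rw [eval_aeval_eq_eval]
    congr 2
    ext k
    simp [mul_comm]
  · obtain ⟨c, rfl⟩ := hT B hB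
    exact ⟨fun _ => c, rfl⟩

theorem isHomogeneous_sum_smul_X {n : ℕ} (x : Fin (n + 1) → ℂ) :
    (∑ i, x i • X i : S n).IsHomogeneous 1 :=
  (homogeneousSubmodule (Fin (n + 1)) ℂ 1).sum_mem fun i _ =>
    Submodule.smul_mem _ _ (isHomogeneous_X ℂ i)

/-- The square of the linear form with coefficients `x`. -/
def sqLinearForm {n : ℕ} (x : Fin (n + 1) → ℂ) : homogeneousSubmodule (Fin (n + 1)) ℂ 2 :=
  ⟨(∑ i, x i • X i) ^ 2, (isHomogeneous_sum_smul_X x).pow 2⟩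

theorem range_sqLinearForm (n : ℕ) :
    Set.range (sqLinearForm (n := n)) = {A : homogeneousSubmodule (Fin (n + 1)) ℂ 2 |
      ∃ x : S n, x.IsHomogeneous 1 ∧ (A : S n) = x ^ 2} := by
  ext A
  constructor
  · rintro ⟨x, rfl⟩
    exact ⟨_, isHomogeneous_sum_smul_X x, rfl⟩
  · rintro ⟨y, hy, hA⟩
    obtain ⟨x, rfl⟩ := exists_eq_sum_smul_X hy
    exact ⟨x, Subtype.ext hA.symm⟩

theorem eq_setOf_sq_of_algDimGE {n : ℕ} {T : Set (homogeneousSubmodule (Fin (n + 1)) ℂ 2)}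
    (hT : IsZariskiClosed T) (hdim : algDimGE T (n + 1))
    (hsub : T ⊆ Set.range sqLinearForm) : T = Set.range sqLinearForm := by
  let M := homogeneousSubmodule (Fin (n + 1)) ℂ 2
  have b := Module.finBasis ℂ M
  let e (i j : Fin (n + 1)) : M := ⟨X i * X j, (isHomogeneous_X ℂ i).mul (isHomogeneous_X ℂ j)⟩
  have hsq (x : Fin (n + 1) → ℂ) : sqLinearForm x = ∑ i, ∑ j, (x i * x j) • e i j := by
    refine Subtype.ext ?_
    simp only [sqLinearForm, Submodule.coe_sum, Submodule.coe_smul, e, pow_two,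
      Finset.sum_mul_sum, smul_mul_smul_comm]
  let θ : MvPolynomial (Fin (Module.finrank ℂ M)) ℂ →ₐ[ℂ] MvPolynomial (Fin (n + 1)) ℂ :=
    aeval fun k => ∑ i, ∑ j, C (b.equivFun (e i j) k) * (X i * X j)
  have hθ (x p) : eval x (θ p) = eval (b.equivFun (sqLinearForm x)) p := by
    simp only [θ]
    rw [eval_aeval_eq_eval, hsq]
    congr 2
    ext k
    simp only [map_sum, map_smul, map_mul, eval_C, eval_X, Finset.sum_apply, Pi.smul_apply,
      smul_eq_mul, mul_comm]
  refine (algDimGE_subset_range b θ (isIntegral_of_forall_eq_X_pow two_pos fun i => ?_)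
    sqLinearForm hθ hsub hdim).2 rfl hT
  let l : M →ₗ[ℂ] ℂ := (aeval (Pi.single i (1 : ℂ))).toLinearMap ∘ₗ M.subtype
  refine ⟨∑ k, C (l (b k)) * X k, MvPolynomial.funext fun x => ?_⟩
  rw [hθ, map_sum]
  simp only [map_mul, eval_C, eval_X, map_pow]
  rw [← apply_eq_sum_mul_equivFun]
  simp [l, sqLinearForm, Pi.single_apply]

theorem exists_eq_smul_of_mul_eq_sq {n : ℕ} {A B D : S n} (hA : A.IsHomogeneous 2)
    (hB : B.IsHomogeneous 2) (h : A * B = D ^ 2)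
    (hsq : ¬ ∃ x : S n, x.IsHomogeneous 1 ∧ A = x ^ 2) : ∃ c : ℂ, B = c • A := by
  have hA0 : A ≠ 0 := by
    rintro rfl
    exact hsq ⟨0, isHomogeneous_zero _ _ _, by simp⟩
  by_cases hsf : Squarefree A
  · obtain ⟨E, rfl⟩ := hsf.isRadical 2 D (Dvd.intro _ h)
    have hB' : B = A * E ^ 2 := mul_left_cancel₀ hA0 (by rw [h]; ring)
    have hc := homogeneousComponent_mul_of_isHomogeneous (j := 0) (b := E ^ 2) hA
    rw [← hB', homogeneousComponent_of_mem hB, if_pos rfl, homogeneousComponent_zero] at hc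
    exact ⟨_, by rw [hc, smul_eq_C_mul, mul_comm]⟩
  · exfalso
    simp only [Squarefree, not_forall] at hsf
    obtain ⟨x, ⟨c, hc⟩, hx⟩ := hsf
    have hx0 : x ≠ 0 := by
      rintro rfl
      exact hA0 (by simpa using hc)
    have hc0 : c ≠ 0 := by
      rintro rfl
      exact hA0 (by simpa using hc)
    have hdeg := hA.totalDegree hA0
    rw [hc, totalDegree_mul_of_isDomain (mul_ne_zero hx0 hx0) hc0,
      totalDegree_mul_of_isDomain hx0 hx0] at hdeg
    have hxd : x.totalDegree ≠ 0 := by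
      intro h0
      rw [totalDegree_eq_zero_iff_eq_C] at h0
      refine hx ?_
      rw [h0]
      refine IsUnit.map C (isUnit_iff_ne_zero.2 fun h1 => hx0 ?_)
      rw [h0, h1, map_zero]
    have hx1 : x.totalDegree = 1 := by omega
    have hc1 := totalDegree_eq_zero_iff_eq_C.1 (show c.totalDegree = 0 by omega)
    obtain ⟨e, he⟩ := IsAlgClosed.exists_pow_nat_eq (coeff 0 c) two_pos
    have hAy : A = (C e * x) ^ 2 := by
      rw [hc, hc1, ← he, map_pow]
      ring
    have hy0 : coeff 0 (C e * x) = 0 := by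
      have h0 := congrArg constantCoeff hAy
      rw [map_pow, constantCoeff_eq, hA.coeff_eq_zero (by simp)] at h0
      exact pow_eq_zero_iff two_ne_zero |>.1 h0.symm
    have hy : homogeneousComponent 1 (C e * x) = C e * x := by
      have h1 := sum_homogeneousComponent x
      rw [hx1, Finset.sum_range_succ, Finset.sum_range_one, homogeneousComponent_zero] at h1
      rw [homogeneousComponent_C_mul]
      nth_rw 2 [← h1]
      rw [mul_add, ← C_mul, ← coeff_C_mul, hy0, C_0, zero_add]
    exact hsq ⟨_, homogeneousComponent_isHomogeneous 1 (C e * x), by rw [hy, hAy]⟩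

/-- Proposition, degree 4 case.
For `n ≥ 599` and generic `f ∈ S⁴`: the only Zariski-closed algebraic subset
`T ⊆ S² = R_f²` of dimension `≥ n+1` such that `A·B mod J_f` is a square in `R_f⁴`
for all `A, B ∈ T` is the set of squares of linear forms. -/
theorem squares_characterization_deg4 (n : ℕ) (hn : 599 ≤ n) :
    GenericallyHolds (fun f : MvPolynomial.homogeneousSubmodule (Fin (n + 1)) ℂ 4 =>
      ∀ T : Set (MvPolynomial.homogeneousSubmodule (Fin (n + 1)) ℂ 2),
        IsZariskiClosed T → algDimGE T (n + 1) →
        (∀ A ∈ T, ∀ B ∈ T, ∃ C : S n, C.IsHomogeneous 2 ∧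
          (A : S n) * (B : S n) - C ^ 2 ∈ jacobianIdeal (f : S n)) →
        T = {A : MvPolynomial.homogeneousSubmodule (Fin (n + 1)) ℂ 2 |
          ∃ x : S n, x.IsHomogeneous 1 ∧ (A : S n) = x ^ 2}) := by
  obtain ⟨φ, hφ, hne, h⟩ := generically_mul_eq_sq hn
  refine ⟨φ, hφ, hne, fun f hf T hT hdim hsq => ?_⟩
  rw [← range_sqLinearForm]
  refine eq_setOf_sq_of_algDimGE hT hdim fun A hA => ?_
  rw [range_sqLinearForm]
  by_contra hA'
  have hA0 : A ≠ 0 := by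
    rintro rfl
    exact hA' ⟨0, isHomogeneous_zero _ _ _, by simp⟩
  have := le_one_of_algDimGE_line hA0 (fun B hB => ?_) hdim
  · omega
  obtain ⟨C, hC, hABC⟩ := hsq A hA B hB
  obtain ⟨c, hc⟩ := exists_eq_smul_of_mul_eq_sq A.2 B.2 (h f hf A B C A.2 B.2 hC hABC) hA'
  exact ⟨c, Subtype.ext hc⟩

end
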